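/- Let ρ' be a normalized state on registers A, R, C, let 𝒩: R → B be a quantum channel (completely positive trace-preserving map), and set ρ_ABC = 𝒩(ρ'_ARC) (with 𝒩 acting as the identity on A and C). Then for any α ∈ (0,1)∪(1,∞): I_α↓(C;AB)_{𝒩(ρ')} ≤ I_α↓(C;A)_{ρ'} + sup over normalized states ω on A, R, C of I_α↓(AC;B)_{𝒩(ω)}. -/

import Mathlib

open scoped Kronecker
open Matrix
open scoped ComplexOrder

noncomputable section
namespace QITLeak

variable {A B : Type*}

/-- Real matrix power via spectral decomposition (Moore–Penrose pseudoinverse powers,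
since `(0:ℝ) ^ (p:ℝ) = 0` for `p ≠ 0`). Junk value `0` on non-Hermitian input. -/
noncomputable def mpow [Fintype A] [DecidableEq A] (ρ : Matrix A A ℂ) (p : ℝ) :
    Matrix A A ℂ :=
  if hρ : ρ.IsHermitian then
    (hρ.eigenvectorUnitary : Matrix A A ℂ) *
      Matrix.diagonal (fun i => ((hρ.eigenvalues i ^ p : ℝ) : ℂ)) *
      (star (hρ.eigenvectorUnitary : Matrix A A ℂ))
  else 0

/-- A normalized state (density matrix). -/
def IsState [Fintype A] (ρ : Matrix A A ℂ) : Prop := ρ.PosSemidef ∧ ρ.trace = 1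

/-- A subnormalized state. -/
def IsSubState [Fintype A] (ρ : Matrix A A ℂ) : Prop := ρ.PosSemidef ∧ (ρ.trace).re ≤ 1

/-- Partial trace over the second tensor factor. -/
def ptB [Fintype B] (ρ : Matrix (A × B) (A × B) ℂ) : Matrix A A ℂ :=
  Matrix.of fun a a' => ∑ b, ρ (a, b) (a', b)

/-- Partial trace over the first tensor factor. -/
def ptA [Fintype A] (ρ : Matrix (A × B) (A × B) ℂ) : Matrix B B ℂ :=
  Matrix.of fun b b' => ∑ a, ρ (a, b) (a, b')

/-- Partial trace over the factor `B`, along a decomposition `X ≃ A × B` of the registers. -/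
def traceOut {X A B : Type*} [Fintype B] (e : X ≃ A × B) (ρ : Matrix X X ℂ) :
    Matrix A A ℂ :=
  Matrix.of fun a a' => ∑ b, ρ (e.symm (a, b)) (e.symm (a', b))

/-- Support inclusion `supp ρ ⊆ supp σ` (for PSD matrices: kernel inclusion). -/
def suppSubset [Fintype A] (ρ σ : Matrix A A ℂ) : Prop :=
  ∀ v : A → ℂ, σ *ᵥ v = 0 → ρ *ᵥ v = 0

/-- The real-valued core formula of the sandwiched Rényi divergence (base 2). -/
def DR (α : ℝ) [Fintype A] [DecidableEq A] (ρ σ : Matrix A A ℂ) : ℝ :=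
  (α - 1)⁻¹ * Real.logb 2
    (((mpow (mpow σ ((1 - α) / (2 * α)) * ρ * mpow σ ((1 - α) / (2 * α))) α).trace.re)
      / (ρ.trace).re)

open scoped Classical in
/-- The sandwiched Rényi divergence `D_α(ρ‖σ)`, with value `⊤` outside the
support/orthogonality conditions. -/
def D (α : ℝ) [Fintype A] [DecidableEq A] (ρ σ : Matrix A A ℂ) : EReal :=
  if (α < 1 ∧ ¬ (ρ * σ = 0 ∧ σ * ρ = 0)) ∨ suppSubset ρ σ then ((DR α ρ σ : ℝ) : EReal)
  else ⊤

/-- The max-divergence `D_∞(ρ‖σ)`: log of the least `μ ≥ 0` with `ρ ≤ μσ` (`⊤` if none). -/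
def Dmax [Fintype A] (ρ σ : Matrix A A ℂ) : EReal :=
  sInf {x : EReal | ∃ μ : ℝ, 0 ≤ μ ∧ (μ • σ - ρ).PosSemidef ∧ x = ((Real.logb 2 μ : ℝ) : EReal)}

section Ent
variable [Fintype A] [DecidableEq A] [Fintype B] [DecidableEq B]

/-- `H_α↑(A|B)_ρ` for `ρ` on `A × B`. -/
def HUp (α : ℝ) (ρ : Matrix (A × B) (A × B) ℂ) : EReal :=
  - sInf {x : EReal | ∃ σ : Matrix B B ℂ, IsState σ ∧ x = D α ρ ((1 : Matrix A A ℂ) ⊗ₖ σ)}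

/-- `H_α(A|B)_ρ` for `ρ` on `A × B`. -/
def Hdn (α : ℝ) (ρ : Matrix (A × B) (A × B) ℂ) : EReal :=
  - D α ρ ((1 : Matrix A A ℂ) ⊗ₖ ptA ρ)

/-- `I_α↓(A;B)_ρ` for `ρ` on `A × B`. -/
def Idown (α : ℝ) (ρ : Matrix (A × B) (A × B) ℂ) : EReal :=
  sInf {x : EReal | ∃ σ : Matrix B B ℂ, IsState σ ∧ x = D α ρ ((ptB ρ) ⊗ₖ σ)}

/-- `I_α(A:B)_ρ` for `ρ` on `A × B`. -/
def Imut (α : ℝ) (ρ : Matrix (A × B) (A × B) ℂ) : EReal :=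
  D α ρ ((ptB ρ) ⊗ₖ (ptA ρ))

/-- `I_α↓↓(A:B)_ρ` for `ρ` on `A × B`. -/
def Idd (α : ℝ) (ρ : Matrix (A × B) (A × B) ℂ) : EReal :=
  sInf {x : EReal | ∃ (ω : Matrix A A ℂ) (σ : Matrix B B ℂ),
    IsState ω ∧ IsState σ ∧ x = D α ρ (ω ⊗ₖ σ)}

/-- `H_min↑(A|B)_ρ = H_∞↑(A|B)_ρ`. -/
def HminUp (ρ : Matrix (A × B) (A × B) ℂ) : EReal :=
  - sInf {x : EReal | ∃ σ : Matrix B B ℂ, IsState σ ∧ x = Dmax ρ ((1 : Matrix A A ℂ) ⊗ₖ σ)}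

/-- `I_∞↓(A;B)_ρ`. -/
def ImaxD (ρ : Matrix (A × B) (A × B) ℂ) : EReal :=
  sInf {x : EReal | ∃ σ : Matrix B B ℂ, IsState σ ∧ x = Dmax ρ ((ptB ρ) ⊗ₖ σ)}

/-- `I_∞(A:B)_ρ` (unoptimized max-information). -/
def ImaxND (ρ : Matrix (A × B) (A × B) ℂ) : EReal :=
  Dmax ρ ((ptB ρ) ⊗ₖ (ptA ρ))

/-- `I_∞↓↓(A:B)_ρ`. -/
def IddMax (ρ : Matrix (A × B) (A × B) ℂ) : EReal :=
  sInf {x : EReal | ∃ (ω : Matrix A A ℂ) (σ : Matrix B B ℂ),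
    IsState ω ∧ IsState σ ∧ x = Dmax ρ (ω ⊗ₖ σ)}

end Ent

/-- Trace norm. -/
def traceNorm [Fintype A] [DecidableEq A] (M : Matrix A A ℂ) : ℝ :=
  (mpow (Mᴴ * M) (1 / 2 : ℝ)).trace.re

/-- Generalized fidelity of subnormalized states. -/
def gFid [Fintype A] [DecidableEq A] (ρ σ : Matrix A A ℂ) : ℝ :=
  traceNorm (mpow ρ (1 / 2 : ℝ) * mpow σ (1 / 2 : ℝ)) +
    Real.sqrt ((1 - ρ.trace.re) * (1 - σ.trace.re))

/-- Purified distance. -/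
def pDist [Fintype A] [DecidableEq A] (ρ σ : Matrix A A ℂ) : ℝ :=
  Real.sqrt (1 - gFid ρ σ ^ 2)

section Smooth
variable [Fintype A] [DecidableEq A] [Fintype B] [DecidableEq B]

/-- Smoothed min-entropy `H_min↑,ε(A|B)_ρ`. -/
def HminUpEps (ε : ℝ) (ρ : Matrix (A × B) (A × B) ℂ) : EReal :=
  sSup {x : EReal | ∃ ρ' : Matrix (A × B) (A × B) ℂ,
    IsSubState ρ' ∧ pDist ρ' ρ ≤ ε ∧ x = HminUp ρ'}

/-- Smoothed max-information `I_max↓,ε(A;B)_ρ`. -/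
def ImaxDEps (ε : ℝ) (ρ : Matrix (A × B) (A × B) ℂ) : EReal :=
  sInf {x : EReal | ∃ ρ' : Matrix (A × B) (A × B) ℂ,
    IsSubState ρ' ∧ pDist ρ' ρ ≤ ε ∧ x = ImaxD ρ'}

/-- Smoothed (unoptimized) max-information `I_max^ε(A:B)_ρ`. -/
def ImaxNDEps (ε : ℝ) (ρ : Matrix (A × B) (A × B) ℂ) : EReal :=
  sInf {x : EReal | ∃ ρ' : Matrix (A × B) (A × B) ℂ,
    IsSubState ρ' ∧ pDist ρ' ρ ≤ ε ∧ x = ImaxND ρ'}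

/-- Smoothed max-information `I_max↓↓,ε(A:B)_ρ`. -/
def IddMaxEps (ε : ℝ) (ρ : Matrix (A × B) (A × B) ℂ) : EReal :=
  sInf {x : EReal | ∃ ρ' : Matrix (A × B) (A × B) ℂ,
    IsSubState ρ' ∧ pDist ρ' ρ ≤ ε ∧ x = IddMax ρ'}

/-- Smoothed Rényi conditional entropy `H_α↑,ε(A|B)_ρ`. -/
def HUpEps (α ε : ℝ) (ρ : Matrix (A × B) (A × B) ℂ) : EReal :=
  sSup {x : EReal | ∃ ρ' : Matrix (A × B) (A × B) ℂ,
    IsSubState ρ' ∧ pDist ρ' ρ ≤ ε ∧ x = HUp α ρ'}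

end Smooth

/-- Extension `id_R ⊗ Φ` of a linear map on matrices, with a spectator register on the left. -/
def lext {R A B : Type*} (Φ : Matrix A A ℂ →ₗ[ℂ] Matrix B B ℂ) :
    Matrix (R × A) (R × A) ℂ →ₗ[ℂ] Matrix (R × B) (R × B) ℂ where
  toFun ρ := Matrix.of fun p q => Φ (Matrix.of fun a a' => ρ (p.1, a) (q.1, a')) p.2 q.2
  map_add' x y := by
    ext p q
    show Φ ((Matrix.of fun a a' => x (p.1, a) (q.1, a'))
        + (Matrix.of fun a a' => y (p.1, a) (q.1, a'))) p.2 q.2 = _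
    rw [map_add]; rfl
  map_smul' c x := by
    ext p q
    show Φ (c • (Matrix.of fun a a' => x (p.1, a) (q.1, a'))) p.2 q.2 = _
    rw [_root_.map_smul]; rfl

/-- Extension `Φ ⊗ id_R` of a linear map on matrices, with a spectator register on the right. -/
def rext {A B R : Type*} (Φ : Matrix A A ℂ →ₗ[ℂ] Matrix B B ℂ) :
    Matrix (A × R) (A × R) ℂ →ₗ[ℂ] Matrix (B × R) (B × R) ℂ where
  toFun ρ := Matrix.of fun p q => Φ (Matrix.of fun a a' => ρ (a, p.2) (a', q.2)) p.1 q.1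
  map_add' x y := by
    ext p q
    show Φ ((Matrix.of fun a a' => x (a, p.2) (a', q.2))
        + (Matrix.of fun a a' => y (a, p.2) (a', q.2))) p.1 q.1 = _
    rw [map_add]; rfl
  map_smul' c x := by
    ext p q
    show Φ (c • (Matrix.of fun a a' => x (a, p.2) (a', q.2))) p.1 q.1 = _
    rw [_root_.map_smul]; rfl

/-- Completely positive trace-preserving map (quantum channel). -/
structure IsCPTP {A B : Type*} [Fintype A] [Fintype B]
    (Φ : Matrix A A ℂ →ₗ[ℂ] Matrix B B ℂ) : Prop where
  cp : ∀ (n : ℕ) (ρ : Matrix (Fin n × A) (Fin n × A) ℂ), ρ.PosSemidef →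
    ((lext Φ) ρ).PosSemidef
  tp : ∀ ρ : Matrix A A ℂ, (Φ ρ).trace = ρ.trace

/-- The rank-one (pure) state associated to a vector. -/
def pureState {A : Type*} (ψ : A → ℂ) : Matrix A A ℂ := Matrix.vecMulVec ψ (star ψ)


/-! ## Statement 6
`I_α↓(C;AB)_{𝒩(ρ')} ≤ I_α↓(C;A)_{ρ'} + sup_ω I_α↓(AC;B)_{𝒩(ω)}`.
The state `ρ'` lives on `(C × A) × R` and `𝒩 : R → B` acts as the identity on `C × A`. -/

/-- Register shuffle `(C × A) × B ≃ C × (A × B)`. -/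
def eCA_B (C A B : Type*) : (C × A) × B ≃ C × (A × B) where
  toFun x := (x.1.1, (x.1.2, x.2))
  invFun y := ((y.1, y.2.1), y.2.2)
  left_inv _ := rfl
  right_inv _ := rfl

/-! ### Powers of positive semidefinite matrices -/

/-- `M` is unitarily diagonalized by `V`, with real eigenvalues `d`. The index type of the
eigenvalues may differ from that of the matrix. -/
structure IsSpectral {A I : Type*} [Fintype A] [DecidableEq A] [Fintype I] [DecidableEq I]
    (M : Matrix A A ℂ) (V : Matrix A I ℂ) (d : I → ℝ) : Prop where
  mul_star : V * Vᴴ = 1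
  star_mul : Vᴴ * V = 1
  eq : M = V * diagonal (fun i => (d i : ℂ)) * Vᴴ

section Spectral
variable [Fintype A] [DecidableEq A] [Fintype B] [DecidableEq B]

lemma isSpectral_eigenvectorUnitary {M : Matrix A A ℂ} (hM : M.IsHermitian) :
    IsSpectral M (hM.eigenvectorUnitary : Matrix A A ℂ) hM.eigenvalues where
  mul_star := Unitary.coe_mul_star_self _
  star_mul := Unitary.coe_star_mul_self _
  eq := by
    conv_lhs => rw [hM.spectral_theorem, Unitary.conjStarAlgAut_apply]
    rfl

lemma IsSpectral.isHermitian {I : Type*} [Fintype I] [DecidableEq I] {M : Matrix A A ℂ}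
    {V : Matrix A I ℂ} {d : I → ℝ} (h : IsSpectral M V d) : M.IsHermitian := by
  rw [h.eq]
  refine isHermitian_mul_mul_conjTranspose V (isHermitian_diagonal_of_self_adjoint _ ?_)
  ext i
  simp

lemma IsSpectral.mpow_eq {I : Type*} [Fintype I] [DecidableEq I] {M : Matrix A A ℂ}
    {V : Matrix A I ℂ} {d : I → ℝ} (h : IsSpectral M V d) (p : ℝ) :
    mpow M p = V * diagonal (fun i => ((d i ^ p : ℝ) : ℂ)) * Vᴴ := by
  have hM := h.isHermitian
  have hW := isSpectral_eigenvectorUnitary hM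
  rw [mpow, dif_pos hM]
  set W : Matrix A A ℂ := (hM.eigenvectorUnitary : Matrix A A ℂ)
  set l := hM.eigenvalues
  have h1 : diagonal (fun i => (l i : ℂ)) * (Wᴴ * V) = (Wᴴ * V) * diagonal (fun i => (d i : ℂ)) := by
    calc _ = (Wᴴ * W) * diagonal (fun i => (l i : ℂ)) * Wᴴ * V := by
          rw [hW.star_mul]; simp [Matrix.mul_assoc]
      _ = Wᴴ * M * V := by rw [hW.eq]; simp only [Matrix.mul_assoc]
      _ = (Wᴴ * V) * diagonal (fun i => (d i : ℂ)) * (Vᴴ * V) := by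
          rw [h.eq]; simp only [Matrix.mul_assoc]
      _ = _ := by rw [h.star_mul, Matrix.mul_one]
  have h2 : diagonal (fun i => ((l i ^ p : ℝ) : ℂ)) * (Wᴴ * V)
      = (Wᴴ * V) * diagonal (fun i => ((d i ^ p : ℝ) : ℂ)) := by
    ext i j
    have := congrFun (congrFun h1 i) j
    simp only [diagonal_mul, mul_diagonal] at this ⊢
    by_cases h0 : (Wᴴ * V) i j = 0
    · simp [h0]
    · rw [mul_comm] at this
      have := mul_left_cancel₀ h0 this
      rw [Complex.ofReal_inj.mp this, mul_comm]
  calc _ = W * (diagonal (fun i => ((l i ^ p : ℝ) : ℂ)) * (Wᴴ * V)) * Vᴴ := by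
        simp only [Matrix.mul_assoc, h.mul_star, Matrix.mul_one]; rfl
    _ = (W * Wᴴ) * V * diagonal (fun i => ((d i ^ p : ℝ) : ℂ)) * Vᴴ := by
        rw [h2]; simp only [Matrix.mul_assoc]
    _ = _ := by rw [hW.mul_star, Matrix.one_mul]

lemma IsSpectral.mpow {I : Type*} [Fintype I] [DecidableEq I] {M : Matrix A A ℂ}
    {V : Matrix A I ℂ} {d : I → ℝ} (h : IsSpectral M V d) (p : ℝ) :
    IsSpectral (mpow M p) V (fun i => d i ^ p) :=
  ⟨h.mul_star, h.star_mul, h.mpow_eq p⟩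

lemma IsSpectral.smul {I : Type*} [Fintype I] [DecidableEq I] {M : Matrix A A ℂ}
    {V : Matrix A I ℂ} {d : I → ℝ} (h : IsSpectral M V d) (c : ℝ) :
    IsSpectral ((c : ℂ) • M) V (fun i => c * d i) where
  mul_star := h.mul_star
  star_mul := h.star_mul
  eq := by
    rw [h.eq, ← Matrix.smul_mul, ← Matrix.mul_smul, ← diagonal_smul]
    congr! 3
    ext i
    simp

lemma IsSpectral.mul {I : Type*} [Fintype I] [DecidableEq I] {M M' : Matrix A A ℂ}
    {V : Matrix A I ℂ} {d d' : I → ℝ} (h : IsSpectral M V d) (h' : IsSpectral M' V d') :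
    IsSpectral (M * M') V (fun i => d i * d' i) where
  mul_star := h.mul_star
  star_mul := h.star_mul
  eq := by
    rw [h.eq, h'.eq]
    calc _ = V * diagonal (fun i => (d i : ℂ)) * (Vᴴ * V) * diagonal (fun i => (d' i : ℂ)) * Vᴴ := by
          simp only [Matrix.mul_assoc]
      _ = _ := by
          rw [h.star_mul, Matrix.mul_one, Matrix.mul_assoc V, diagonal_mul_diagonal]
          simp

lemma IsSpectral.congr {I : Type*} [Fintype I] [DecidableEq I] {M M' : Matrix A A ℂ}
    {V : Matrix A I ℂ} {d d' : I → ℝ} (h : IsSpectral M V d) (h' : IsSpectral M' V d')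
    (hd : ∀ i, d i = d' i) : M = M' := by
  rw [h.eq, h'.eq, funext hd]

lemma IsSpectral.kronecker {I J : Type*} [Fintype I] [DecidableEq I] [Fintype J] [DecidableEq J]
    {M : Matrix A A ℂ} {V : Matrix A I ℂ} {d : I → ℝ} (h : IsSpectral M V d)
    {N : Matrix B B ℂ} {W : Matrix B J ℂ} {e : J → ℝ} (h' : IsSpectral N W e) :
    IsSpectral (M ⊗ₖ N) (V ⊗ₖ W) (fun x => d x.1 * e x.2) where
  mul_star := by
    rw [conjTranspose_kronecker, ← mul_kronecker_mul, h.mul_star, h'.mul_star, one_kronecker_one]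
  star_mul := by
    rw [conjTranspose_kronecker, ← mul_kronecker_mul, h.star_mul, h'.star_mul, one_kronecker_one]
  eq := by
    rw [h.eq, h'.eq, conjTranspose_kronecker, mul_kronecker_mul, mul_kronecker_mul,
      diagonal_kronecker_diagonal]
    simp

lemma IsSpectral.reindex {I : Type*} [Fintype I] [DecidableEq I] {M : Matrix A A ℂ}
    {V : Matrix A I ℂ} {d : I → ℝ} (h : IsSpectral M V d) (e : A ≃ B) :
    IsSpectral (Matrix.reindex e e M) (V.submatrix e.symm id) d where
  mul_star := by
    rw [conjTranspose_submatrix, ← Equiv.coe_refl, submatrix_mul_equiv, h.mul_star]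
    simp
  star_mul := by
    rw [conjTranspose_submatrix, submatrix_mul_equiv, h.star_mul, submatrix_id_id]
  eq := by
    rw [h.eq, reindex_apply, conjTranspose_submatrix]
    ext i j
    simp [Matrix.mul_apply]

lemma IsSpectral.trace {I : Type*} [Fintype I] [DecidableEq I] {M : Matrix A A ℂ}
    {V : Matrix A I ℂ} {d : I → ℝ} (h : IsSpectral M V d) :
    M.trace = ((∑ i, d i : ℝ) : ℂ) := by
  rw [h.eq, trace_mul_comm, ← Matrix.mul_assoc, h.star_mul, Matrix.one_mul, trace_diagonal]
  simp

lemma IsSpectral.posSemidef {I : Type*} [Fintype I] [DecidableEq I] {M : Matrix A A ℂ}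
    {V : Matrix A I ℂ} {d : I → ℝ} (h : IsSpectral M V d) (hd : ∀ i, 0 ≤ d i) :
    M.PosSemidef := by
  rw [h.eq]
  refine PosSemidef.mul_mul_conjTranspose_same (PosSemidef.diagonal fun i => ?_) V
  simpa using hd i

lemma exists_isSpectral {M : Matrix A A ℂ} (hM : M.PosSemidef) :
    ∃ (V : Matrix A A ℂ) (d : A → ℝ), IsSpectral M V d ∧ ∀ i, 0 ≤ d i :=
  ⟨_, _, isSpectral_eigenvectorUnitary hM.1, hM.eigenvalues_nonneg⟩

lemma mpow_posSemidef {M : Matrix A A ℂ} (hM : M.PosSemidef) (p : ℝ) :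
    (mpow M p).PosSemidef := by
  obtain ⟨V, d, h, hd⟩ := exists_isSpectral hM
  exact (h.mpow p).posSemidef fun i => Real.rpow_nonneg (hd i) p

lemma mpow_one {M : Matrix A A ℂ} (hM : M.PosSemidef) : mpow M 1 = M := by
  obtain ⟨V, d, h, hd⟩ := exists_isSpectral hM
  exact (h.mpow 1).congr h (by simp)

lemma mpow_mpow {M : Matrix A A ℂ} (hM : M.PosSemidef) (p q : ℝ) :
    mpow (mpow M p) q = mpow M (p * q) := by
  obtain ⟨V, d, h, hd⟩ := exists_isSpectral hM
  exact ((h.mpow p).mpow q).congr (h.mpow _) fun i => (Real.rpow_mul (hd i) p q).symm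

lemma mpow_smul {M : Matrix A A ℂ} (hM : M.PosSemidef) {c : ℝ} (hc : 0 ≤ c) (p : ℝ) :
    mpow ((c : ℂ) • M) p = ((c ^ p : ℝ) : ℂ) • mpow M p := by
  obtain ⟨V, d, h, hd⟩ := exists_isSpectral hM
  exact ((h.smul c).mpow p).congr ((h.mpow p).smul _) fun i => Real.mul_rpow hc (hd i)

lemma mpow_mul_mpow {M : Matrix A A ℂ} (hM : M.PosSemidef) {p q : ℝ} (hpq : p + q ≠ 0) :
    mpow M p * mpow M q = mpow M (p + q) := by
  obtain ⟨V, d, h, hd⟩ := exists_isSpectral hM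
  exact ((h.mpow p).mul (h.mpow q)).congr (h.mpow _) fun i => (Real.rpow_add' (hd i) hpq).symm

lemma mpow_mul_mpow_neg_mul {M : Matrix A A ℂ} (hM : M.PosSemidef) (p : ℝ) :
    mpow M p * mpow M (-p) * M = M := by
  obtain ⟨V, d, h, hd⟩ := exists_isSpectral hM
  refine (((h.mpow p).mul (h.mpow _)).mul h).congr h fun i => ?_
  rcases (hd i).eq_or_lt with h0 | h0
  · simp [← h0]
  · rw [← Real.rpow_add h0]; simp

lemma mul_mpow_mul_mpow_neg {M : Matrix A A ℂ} (hM : M.PosSemidef) (p : ℝ) :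
    M * (mpow M p * mpow M (-p)) = M := by
  obtain ⟨V, d, h, hd⟩ := exists_isSpectral hM
  refine (h.mul ((h.mpow p).mul (h.mpow _))).congr h fun i => ?_
  rcases (hd i).eq_or_lt with h0 | h0
  · simp [← h0]
  · rw [← Real.rpow_add h0]; simp

lemma mpow_commute {M : Matrix A A ℂ} (hM : M.PosSemidef) (p q : ℝ) :
    mpow M p * mpow M q = mpow M q * mpow M p := by
  obtain ⟨V, d, h, hd⟩ := exists_isSpectral hM
  exact ((h.mpow p).mul (h.mpow q)).congr ((h.mpow q).mul (h.mpow p)) fun i => mul_comm _ _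

lemma mpow_kronecker {M : Matrix A A ℂ} (hM : M.PosSemidef) {N : Matrix B B ℂ}
    (hN : N.PosSemidef) (p : ℝ) : mpow (M ⊗ₖ N) p = mpow M p ⊗ₖ mpow N p := by
  obtain ⟨V, d, h, hd⟩ := exists_isSpectral hM
  obtain ⟨W, e, h', he⟩ := exists_isSpectral hN
  exact ((h.kronecker h').mpow p).congr ((h.mpow p).kronecker (h'.mpow p))
    fun i => Real.mul_rpow (hd _) (he _)

lemma mpow_reindex (e : A ≃ B) {M : Matrix A A ℂ} (hM : M.PosSemidef) (p : ℝ) :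
    mpow (Matrix.reindex e e M) p = Matrix.reindex e e (mpow M p) := by
  obtain ⟨V, d, h, hd⟩ := exists_isSpectral hM
  exact ((h.reindex e).mpow p).congr ((h.mpow p).reindex e) fun i => rfl

lemma trace_mpow_pos {M : Matrix A A ℂ} (hM : M.PosSemidef) (h0 : M ≠ 0) (p : ℝ) :
    0 < (mpow M p).trace.re := by
  obtain ⟨V, d, h, hd⟩ := exists_isSpectral hM
  rw [(h.mpow p).trace, Complex.ofReal_re]
  obtain ⟨i, hi⟩ : ∃ i, d i ≠ 0 := by
    by_contra! hc
    exact h0 (by rw [h.eq]; simp [hc])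
  exact Finset.sum_pos' (fun j _ => Real.rpow_nonneg (hd j) p)
    ⟨i, Finset.mem_univ i, Real.rpow_pos_of_pos ((hd i).lt_of_ne' hi) p⟩

/-- If the compression of a positive semidefinite `ρ` by `Q` vanishes, then so does `ρ * Q`. -/
lemma mul_eq_zero_of_conj_eq_zero {I : Type*} [Fintype I] {ρ : Matrix A A ℂ}
    (hρ : ρ.PosSemidef) {Q : Matrix A I ℂ} (h : Qᴴ * ρ * Q = 0) : ρ * Q = 0 := by
  have hs : mpow ρ (1 / 2) * mpow ρ (1 / 2) = ρ := by
    rw [mpow_mul_mpow hρ (by norm_num), add_halves, mpow_one hρ]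
  have hH : (mpow ρ (1 / 2))ᴴ = mpow ρ (1 / 2) := (mpow_posSemidef hρ _).1
  have : (mpow ρ (1 / 2) * Q)ᴴ * (mpow ρ (1 / 2) * Q) = 0 := by
    rw [conjTranspose_mul, hH, ← h]
    conv_rhs => rw [← hs]
    simp only [Matrix.mul_assoc]
  rw [conjTranspose_mul_self_eq_zero] at this
  rw [← hs, Matrix.mul_assoc, this, Matrix.mul_zero]

end Spectral

/-! ### Partial traces and channels acting on one register -/

section Register
variable {R : Type*} [Fintype B] [Fintype R]

lemma trace_ptB [Fintype A] (ρ : Matrix (A × B) (A × B) ℂ) : (ptB ρ).trace = ρ.trace := by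
  simp [ptB, Matrix.trace, Fintype.sum_prod_type]

lemma ptB_conj [Fintype A] [DecidableEq B] (S T : Matrix A A ℂ) (ρ : Matrix (A × B) (A × B) ℂ) :
    ptB ((S ⊗ₖ (1 : Matrix B B ℂ)) * ρ * (T ⊗ₖ (1 : Matrix B B ℂ))) = S * ptB ρ * T := by
  ext a a'
  simp only [ptB, of_apply, Matrix.mul_apply, Fintype.sum_prod_type, kroneckerMap_apply,
    Matrix.one_apply, mul_ite, mul_one, mul_zero, ite_mul, zero_mul, Finset.sum_ite_eq,
    Finset.sum_ite_eq', Finset.mem_univ, if_true, Finset.sum_mul, Finset.mul_sum]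
  rw [Finset.sum_comm]
  refine Finset.sum_congr rfl fun i _ => ?_
  rw [Finset.sum_comm]

lemma ptB_posSemidef {ρ : Matrix (A × B) (A × B) ℂ} (hρ : ρ.PosSemidef) :
    (ptB ρ).PosSemidef := by
  have : ptB ρ = ∑ b, ρ.submatrix (fun a => (a, b)) (fun a => (a, b)) := by
    ext a a'
    simp [ptB, Matrix.sum_apply]
  rw [this]
  exact posSemidef_sum _ fun b _ => hρ.submatrix _

lemma mul_kronecker_one_eq_zero [Fintype A] [DecidableEq A] [DecidableEq B] {ρ : Matrix (A × B) (A × B) ℂ}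
    (hρ : ρ.PosSemidef) {Q : Matrix A A ℂ} (h : ptB ρ * Q = 0) :
    ρ * (Q ⊗ₖ (1 : Matrix B B ℂ)) = 0 := by
  apply mul_eq_zero_of_conj_eq_zero hρ
  rw [← (hρ.conjTranspose_mul_mul_same _).trace_eq_zero_iff, ← trace_ptB,
    conjTranspose_kronecker, conjTranspose_one, ptB_conj, Matrix.mul_assoc, h, Matrix.mul_zero,
    trace_zero]

/-- The support of `ρ` is contained in the support of its marginal. -/
lemma mul_kronecker_one_eq_self [Fintype A] [DecidableEq A] [DecidableEq B]
    {ρ : Matrix (A × B) (A × B) ℂ}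
    (hρ : ρ.PosSemidef) {Q : Matrix A A ℂ} (h : ptB ρ * Q = ptB ρ) :
    ρ * (Q ⊗ₖ (1 : Matrix B B ℂ)) = ρ := by
  have hsub : (Q - 1) ⊗ₖ (1 : Matrix B B ℂ) = Q ⊗ₖ (1 : Matrix B B ℂ) - 1 ⊗ₖ 1 := by
    ext
    simp only [kroneckerMap_apply, Matrix.sub_apply, sub_mul]
  have := mul_kronecker_one_eq_zero hρ (Q := Q - 1) (by rw [Matrix.mul_sub, h]; simp)
  rwa [hsub, Matrix.mul_sub, one_kronecker_one, Matrix.mul_one, sub_eq_zero] at this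

lemma ptB_lext (N : Matrix R R ℂ →ₗ[ℂ] Matrix B B ℂ) (hN : IsCPTP N)
    (ρ : Matrix (A × R) (A × R) ℂ) : ptB (lext N ρ) = ptB ρ := by
  ext a a'
  exact hN.tp (Matrix.of fun r r' => ρ (a, r) (a', r'))

lemma lext_conj [Fintype A] [DecidableEq B] [DecidableEq R]
    (N : Matrix R R ℂ →ₗ[ℂ] Matrix B B ℂ) (S T : Matrix A A ℂ)
    (ρ : Matrix (A × R) (A × R) ℂ) :
    lext N ((S ⊗ₖ (1 : Matrix R R ℂ)) * ρ * (T ⊗ₖ (1 : Matrix R R ℂ)))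
      = (S ⊗ₖ (1 : Matrix B B ℂ)) * lext N ρ * (T ⊗ₖ (1 : Matrix B B ℂ)) := by
  have hN : ∀ p q : A × B, lext N ((S ⊗ₖ (1 : Matrix R R ℂ)) * ρ * (T ⊗ₖ (1 : Matrix R R ℂ))) p q
      = N (∑ j, ∑ i, (T j q.1 * S p.1 i) • Matrix.of fun r r' => ρ (i, r) (j, r')) p.2 q.2 := by
    intro p q
    show N _ p.2 q.2 = _
    refine congrArg (fun X => N X p.2 q.2) ?_
    ext r r'
    simp only [of_apply, Matrix.mul_apply, Fintype.sum_prod_type, kroneckerMap_apply,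
      Matrix.one_apply, mul_ite, mul_one, mul_zero, ite_mul, zero_mul, Finset.sum_ite_eq,
      Finset.sum_ite_eq', Finset.mem_univ, if_true, Finset.sum_mul, Matrix.sum_apply,
      Matrix.smul_apply, smul_eq_mul]
    exact Finset.sum_congr rfl fun j _ => Finset.sum_congr rfl fun i _ => by ring
  ext p q
  rw [hN]
  simp only [map_sum, _root_.map_smul, Matrix.mul_apply, Fintype.sum_prod_type, kroneckerMap_apply,
    Matrix.one_apply, mul_ite, mul_one, mul_zero, ite_mul, zero_mul, Finset.sum_ite_eq,
    Finset.sum_ite_eq', Finset.mem_univ, if_true, Finset.sum_mul, Matrix.sum_apply,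
    Matrix.smul_apply, smul_eq_mul]
  refine Finset.sum_congr rfl fun j _ => Finset.sum_congr rfl fun i _ => ?_
  show _ = S p.1 i * N (Matrix.of fun r r' => ρ (i, r) (j, r')) p.2 q.2 * T j q.1
  ring

lemma lext_posSemidef [Fintype A] (N : Matrix R R ℂ →ₗ[ℂ] Matrix B B ℂ) (hN : IsCPTP N)
    {ρ : Matrix (A × R) (A × R) ℂ} (hρ : ρ.PosSemidef) : (lext N ρ).PosSemidef := by
  let e := Fintype.equivFin A
  have h := (hN.cp _ _ (hρ.submatrix (Prod.map e.symm id))).submatrix (Prod.map e id)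
  convert h using 1
  ext p q
  simp [lext]

end Register

/-! ### The sandwiched Rényi divergence -/

section Divergence
variable [Fintype A] [DecidableEq A] [Fintype B] [DecidableEq B]

lemma suppSubset.mul_mpow {ρ σ : Matrix A A ℂ} (hσ : σ.PosSemidef) (h : suppSubset ρ σ) (p : ℝ) :
    ρ * (mpow σ p * mpow σ (-p)) = ρ := by
  refine ext_of_mulVec_single fun i => ?_
  set v : A → ℂ := Pi.single i 1
  have := h ((mpow σ p * mpow σ (-p)) *ᵥ v - v) (by
    rw [mulVec_sub, mulVec_mulVec, mul_mpow_mul_mpow_neg hσ, sub_self])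
  rw [mulVec_sub, sub_eq_zero, mulVec_mulVec] at this
  exact this

lemma suppSubset_of_mul_eq {ρ σ : Matrix A A ℂ} (hσ : σ.PosSemidef)
    (h : ρ * (mpow σ 1 * mpow σ (-1)) = ρ) : suppSubset ρ σ := by
  intro v hv
  rw [← h, mpow_commute hσ, mpow_one hσ, ← Matrix.mul_assoc, ← mulVec_mulVec, hv, mulVec_zero]

/-- Orthogonality is detected by the sandwiched operator, for any nonzero exponent. -/
lemma sandwich_eq_zero_iff {ρ σ : Matrix A A ℂ} (hρ : ρ.PosSemidef) (hσ : σ.PosSemidef)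
    {s : ℝ} (hs : s ≠ 0) : mpow σ s * ρ * mpow σ s = 0 ↔ ρ * σ = 0 ∧ σ * ρ = 0 := by
  have hH : (mpow σ s)ᴴ = mpow σ s := (mpow_posSemidef hσ s).1
  constructor
  · intro h
    have h1 : ρ * mpow σ s = 0 := mul_eq_zero_of_conj_eq_zero hρ (by rwa [hH])
    have h2 : ρ * σ = 0 := by
      rw [← mpow_mul_mpow_neg_mul hσ s, ← Matrix.mul_assoc, ← Matrix.mul_assoc, h1]
      simp
    refine ⟨h2, ?_⟩
    have := congrArg conjTranspose h2
    rwa [conjTranspose_mul, hρ.1.eq, hσ.1.eq, conjTranspose_zero] at this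
  · rintro ⟨h, -⟩
    have : σ * (mpow σ (-1) * mpow σ s) = mpow σ s := by
      obtain ⟨V, d, hd, hd0⟩ := exists_isSpectral hσ
      refine (hd.mul ((hd.mpow (-1)).mul (hd.mpow s))).congr (hd.mpow s) fun i => ?_
      rcases (hd0 i).eq_or_lt with h0 | h0
      · simp [← h0, hs]
      · rw [Real.rpow_neg_one, mul_inv_cancel_left₀ h0.ne']
    rw [Matrix.mul_assoc, ← this, ← Matrix.mul_assoc ρ, h]
    simp

lemma D_cases {ρ σ : Matrix A A ℂ} {α : ℝ} (h : D α ρ σ ≠ ⊤) :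
    ((α < 1 ∧ ¬ (ρ * σ = 0 ∧ σ * ρ = 0)) ∨ suppSubset ρ σ) ∧ D α ρ σ = (DR α ρ σ : ℝ) := by
  unfold D at h ⊢
  split_ifs at h ⊢ with hc
  · exact ⟨hc, rfl⟩
  · exact absurd rfl h

lemma sandwich_ne_zero {ρ σ : Matrix A A ℂ} (hρ : ρ.PosSemidef) (hσ : σ.PosSemidef) (h0 : ρ ≠ 0)
    {α s : ℝ} (hs : s ≠ 0) (h : D α ρ σ ≠ ⊤) : mpow σ s * ρ * mpow σ s ≠ 0 := by
  rw [Ne, sandwich_eq_zero_iff hρ hσ hs]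
  rcases (D_cases h).1 with h | h
  · exact h.2
  · rintro ⟨h1, -⟩
    have := h.mul_mpow hσ 1
    rw [mpow_one hσ, ← Matrix.mul_assoc, h1, Matrix.zero_mul] at this
    exact h0 this.symm

lemma sandwich_posSemidef {ρ σ : Matrix A A ℂ} (hρ : ρ.PosSemidef) (hσ : σ.PosSemidef) (s : ℝ) :
    (mpow σ s * ρ * mpow σ s).PosSemidef := by
  have := hρ.mul_mul_conjTranspose_same (mpow σ s)
  rwa [(mpow_posSemidef hσ s).1.eq] at this

lemma D_reindex (e : A ≃ B) {ρ σ : Matrix A A ℂ} (hρ : ρ.PosSemidef) (hσ : σ.PosSemidef) (α : ℝ) :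
    D α (Matrix.reindex e e ρ) (Matrix.reindex e e σ) = D α ρ σ := by
  have hmul : ∀ X Y : Matrix A A ℂ,
      Matrix.reindex e e X * Matrix.reindex e e Y = Matrix.reindex e e (X * Y) := by
    intro X Y
    simp [submatrix_mul_equiv]
  have hz : ∀ X : Matrix A A ℂ, Matrix.reindex e e X = 0 ↔ X = 0 := fun X =>
    ⟨fun h => (Matrix.reindex e e).injective (h.trans (by ext; simp)), fun h => by subst h; ext; simp⟩
  have htr : ∀ X : Matrix A A ℂ, (Matrix.reindex e e X).trace = X.trace := fun X =>
    Fintype.sum_equiv e.symm _ _ fun i => rfl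
  have hsupp : suppSubset (Matrix.reindex e e ρ) (Matrix.reindex e e σ) ↔ suppSubset ρ σ := by
    constructor
    · intro h
      refine fun v hv => ?_
      have := h (v ∘ e.symm) (by
        simp [Matrix.reindex_apply, submatrix_mulVec_equiv, Function.comp_assoc, hv])
      simp only [Matrix.reindex_apply, submatrix_mulVec_equiv, Equiv.symm_symm, Function.comp_assoc,
        Equiv.symm_comp_self, Function.comp_id] at this
      ext i
      simpa using congrFun this (e i)
    · intro h v hv
      have := h (v ∘ e) (by
        simp only [Matrix.reindex_apply, submatrix_mulVec_equiv, Equiv.symm_symm] at hv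
        ext i
        simpa using congrFun hv (e i))
      simp [Matrix.reindex_apply, submatrix_mulVec_equiv, this]
  have hDR : DR α (Matrix.reindex e e ρ) (Matrix.reindex e e σ) = DR α ρ σ := by
    unfold DR
    rw [mpow_reindex e hσ, hmul, hmul, mpow_reindex e (sandwich_posSemidef hρ hσ _), htr, htr]
  have hcond : ((α < 1 ∧ ¬ (Matrix.reindex e e ρ * Matrix.reindex e e σ = 0 ∧
      Matrix.reindex e e σ * Matrix.reindex e e ρ = 0)) ∨
      suppSubset (Matrix.reindex e e ρ) (Matrix.reindex e e σ)) ↔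
      ((α < 1 ∧ ¬ (ρ * σ = 0 ∧ σ * ρ = 0)) ∨ suppSubset ρ σ) := by
    rw [hmul, hmul, hz, hz, hsupp]
  unfold D
  by_cases h : (α < 1 ∧ ¬ (ρ * σ = 0 ∧ σ * ρ = 0)) ∨ suppSubset ρ σ
  · rw [if_pos (hcond.mpr h), if_pos h, hDR]
  · rw [if_neg (mt hcond.mp h), if_neg h]

lemma IsSpectral.trace_mul {I : Type*} [Fintype I] [DecidableEq I] {M : Matrix A A ℂ}
    {V : Matrix A I ℂ} {d : I → ℝ} (h : IsSpectral M V d) (ρ : Matrix A A ℂ) :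
    (ρ * M).trace.re = ∑ i, ((Vᴴ * ρ * V) i i).re * d i := by
  rw [h.eq, ← Matrix.mul_assoc, trace_mul_comm, ← Matrix.mul_assoc, ← Matrix.mul_assoc]
  simp [Matrix.trace, mul_diagonal]

lemma IsState.eigenvalue_le_one {I : Type*} [Fintype I] [DecidableEq I] {σ : Matrix A A ℂ}
    (hσ : IsState σ) {V : Matrix A I ℂ} {d : I → ℝ} (h : IsSpectral σ V d) (hd : ∀ i, 0 ≤ d i)
    (i : I) : d i ≤ 1 := by
  have h1 : ∑ i, d i = 1 := by
    have := h.trace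
    rw [hσ.2] at this
    exact_mod_cast this.symm
  rw [← h1]
  exact Finset.single_le_sum (fun j _ => hd j) (Finset.mem_univ i)

lemma trace_sandwich_le_one {ρ σ : Matrix A A ℂ} (hρ : IsState ρ) (hσ : IsState σ) {s : ℝ}
    (hs : 0 ≤ s) : (mpow σ s * ρ * mpow σ s).trace.re ≤ 1 := by
  obtain ⟨V, d, h, hd⟩ := exists_isSpectral hσ.1
  have hw : ∀ i, 0 ≤ ((Vᴴ * ρ * V) i i).re := fun i =>
    (Complex.nonneg_iff.mp (hρ.1.conjTranspose_mul_mul_same V).diag_nonneg).1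
  have h1 : ∑ i, ((Vᴴ * ρ * V) i i).re = 1 := by
    have : (Vᴴ * ρ * V).trace = 1 := by
      rw [trace_mul_comm, ← Matrix.mul_assoc, h.mul_star, Matrix.one_mul, hρ.2]
    simpa [Matrix.trace] using congrArg Complex.re this
  rw [trace_mul_comm, ← Matrix.mul_assoc, trace_mul_comm, ((h.mpow s).mul (h.mpow s)).trace_mul,
    ← h1]
  refine Finset.sum_le_sum fun i _ => mul_le_of_le_one_right (hw i) ?_
  have := Real.rpow_le_one (hd i) (hσ.eigenvalue_le_one h hd i) hs
  exact mul_le_one₀ this (Real.rpow_nonneg (hd i) s) this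

lemma one_le_trace_sandwich {ρ σ : Matrix A A ℂ} (hρ : IsState ρ) (hσ : IsState σ)
    (hsupp : suppSubset ρ σ) {s : ℝ} (hs : s ≤ 0) :
    1 ≤ (mpow σ s * ρ * mpow σ s).trace.re := by
  obtain ⟨V, d, h, hd⟩ := exists_isSpectral hσ.1
  have hw : ∀ i, 0 ≤ ((Vᴴ * ρ * V) i i).re := fun i =>
    (Complex.nonneg_iff.mp (hρ.1.conjTranspose_mul_mul_same V).diag_nonneg).1
  have h1 := ((h.mpow s).mul (h.mpow (-s))).trace_mul ρ
  rw [hsupp.mul_mpow hσ.1, hρ.2, Complex.one_re] at h1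
  rw [trace_mul_comm, ← Matrix.mul_assoc, trace_mul_comm, ((h.mpow s).mul (h.mpow s)).trace_mul,
    h1]
  refine Finset.sum_le_sum fun i _ => mul_le_mul_of_nonneg_left ?_ (hw i)
  refine mul_le_mul_of_nonneg_left ?_ (Real.rpow_nonneg (hd i) s)
  rcases (hd i).eq_or_lt with h0 | h0
  · rcases hs.eq_or_lt with h2 | h2
    · simp [h2]
    · simp [← h0, h2.ne]
  · exact Real.rpow_le_rpow_of_exponent_ge h0 (hσ.eigenvalue_le_one h hd i) (by linarith)

/-- A crude dimension-dependent lower bound on the sandwiched Rényi divergence of states. -/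
lemma exists_le_D {α : ℝ} (h0 : 0 < α) (h1 : α ≠ 1) :
    ∃ c : ℝ, ∀ ρ σ : Matrix A A ℂ, IsState ρ → IsState σ → (c : EReal) ≤ D α ρ σ := by
  rcases h1.lt_or_gt with h1 | h1
  · refine ⟨(α - 1)⁻¹ * Real.logb 2 (Fintype.card A), fun ρ σ hρ hσ => ?_⟩
    by_cases htop : D α ρ σ = ⊤
    · simp [htop]
    rw [(D_cases htop).2, EReal.coe_le_coe_iff, DR, hρ.2, Complex.one_re, div_one]
    refine mul_le_mul_of_nonpos_left ?_ (inv_nonpos.mpr (by linarith))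
    set s := (1 - α) / (2 * α)
    have hs : 0 < s := div_pos (by linarith) (by linarith)
    have hpos := trace_mpow_pos (sandwich_posSemidef hρ.1 hσ.1 s)
      (sandwich_ne_zero hρ.1 hσ.1 (fun h => by simpa [h] using hρ.2) hs.ne' htop) α
    refine Real.logb_le_logb_of_le (by norm_num) hpos ?_
    have hle := trace_sandwich_le_one hρ hσ hs.le
    obtain ⟨V, d, h, hd⟩ := exists_isSpectral (sandwich_posSemidef hρ.1 hσ.1 s)
    rw [h.trace, Complex.ofReal_re] at hle
    rw [(h.mpow α).trace, Complex.ofReal_re]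
    calc ∑ i, d i ^ α ≤ ∑ _i : A, (1 : ℝ) := Finset.sum_le_sum fun i _ =>
          Real.rpow_le_one (hd i)
            ((Finset.single_le_sum (fun j _ => hd j) (Finset.mem_univ i)).trans hle) h0.le
      _ = _ := by simp
  · refine ⟨(α - 1)⁻¹ * Real.logb 2 ((Fintype.card A : ℝ)⁻¹ ^ α), fun ρ σ hρ hσ => ?_⟩
    by_cases htop : D α ρ σ = ⊤
    · simp [htop]
    have hsupp : suppSubset ρ σ := (D_cases htop).1.resolve_left fun h => by linarith [h.1]
    rw [(D_cases htop).2, EReal.coe_le_coe_iff, DR, hρ.2, Complex.one_re, div_one]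
    refine mul_le_mul_of_nonneg_left ?_ (inv_nonneg.mpr (by linarith))
    set s := (1 - α) / (2 * α)
    have hs : s < 0 := div_neg_of_neg_of_pos (by linarith) (by linarith)
    have hle := one_le_trace_sandwich hρ hσ hsupp hs.le
    obtain ⟨V, d, h, hd⟩ := exists_isSpectral (sandwich_posSemidef hρ.1 hσ.1 s)
    rw [h.trace, Complex.ofReal_re] at hle
    rw [(h.mpow α).trace, Complex.ofReal_re]
    have hne : Nonempty A := by
      by_contra hA
      rw [not_nonempty_iff] at hA
      simp at hle
      linarith
    obtain ⟨i, -, hi⟩ := Finset.exists_le_of_sum_le (s := Finset.univ)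
      (f := fun _ : A => (Fintype.card A : ℝ)⁻¹) (g := d) Finset.univ_nonempty
      (by simpa using hle)
    have hcard : (0 : ℝ) < (Fintype.card A : ℝ)⁻¹ := by
      have : 0 < Fintype.card A := Fintype.card_pos
      positivity
    refine Real.logb_le_logb_of_le (by norm_num) (Real.rpow_pos_of_pos hcard α) ?_
    exact (Real.rpow_le_rpow hcard.le hi h0.le).trans
      (Finset.single_le_sum (f := fun i => d i ^ α) (fun j _ => Real.rpow_nonneg (hd j) α)
        (Finset.mem_univ i))

/-- Chain rule for the sandwiched Rényi divergence relative to a product operator: tilting the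
marginal `r` by `T` turns the divergence of an extension of `r` into a sum of two divergences. -/
lemma exists_tilt (B : Type*) [Fintype B] [DecidableEq B] {r τ : Matrix A A ℂ}
    (hr : r.PosSemidef) (hτ : τ.PosSemidef) (hrtr : r.trace = 1) {α : ℝ} (h0 : 0 < α)
    (h1 : α ≠ 1) (hfin : D α r τ ≠ ⊤) :
    ∃ T : Matrix A A ℂ, (T * r * Tᴴ).trace = 1 ∧
      ∀ ρ : Matrix (A × B) (A × B) ℂ, ρ.PosSemidef → ptB ρ = r → ∀ σ : Matrix B B ℂ, σ.PosSemidef →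
        D α ρ (τ ⊗ₖ σ) ≤ D α r τ +
          D α ((T ⊗ₖ (1 : Matrix B B ℂ)) * ρ * (Tᴴ ⊗ₖ (1 : Matrix B B ℂ)))
            ((T * r * Tᴴ) ⊗ₖ σ) := by
  have hr0 : r ≠ 0 := fun h => by simp [h] at hrtr
  obtain ⟨s, hs⟩ : ∃ s, s = (1 - α) / (2 * α) := ⟨_, rfl⟩
  have hs0 : s ≠ 0 := by
    rw [hs]
    exact div_ne_zero (sub_ne_zero.mpr h1.symm) (by positivity)
  obtain ⟨a, ha⟩ : ∃ a, a = (α - 1) / 2 := ⟨_, rfl⟩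
  obtain ⟨X, hX⟩ : ∃ X, X = mpow τ s := ⟨_, rfl⟩
  have hXH : Xᴴ = X := by rw [hX]; exact (mpow_posSemidef hτ s).1
  obtain ⟨M, hMdef⟩ : ∃ M, M = X * r * X := ⟨_, rfl⟩
  have hM : M.PosSemidef := by rw [hMdef, hX]; exact sandwich_posSemidef hr hτ s
  have hM0 : M ≠ 0 := by rw [hMdef, hX]; exact sandwich_ne_zero hr hτ hr0 hs0 hfin
  obtain ⟨Z, hZdef⟩ : ∃ Z, Z = (mpow M α).trace.re := ⟨_, rfl⟩
  have hZ : 0 < Z := by rw [hZdef]; exact trace_mpow_pos hM hM0 α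
  have hZtr : (mpow M α).trace = (Z : ℂ) := by
    obtain ⟨V, d, h, hd⟩ := exists_isSpectral hM
    rw [hZdef, (h.mpow α).trace, Complex.ofReal_re]
  obtain ⟨W, hW⟩ : ∃ W, W = mpow M a := ⟨_, rfl⟩
  obtain ⟨W', hW'⟩ : ∃ W', W' = mpow M (-a) := ⟨_, rfl⟩
  have hWH : Wᴴ = W := by rw [hW]; exact (mpow_posSemidef hM a).1
  have hWM : W * M * W = mpow M α := by
    have e1 : a + 1 ≠ 0 := by rw [ha]; intro h; linarith
    have e2 : a + 1 + a = α := by rw [ha]; ring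
    have := mpow_mul_mpow hM (p := a) (q := 1) e1
    rw [mpow_one hM] at this
    rw [hW, this, mpow_mul_mpow hM (by rw [e2]; exact h0.ne'), e2]
  have hMWW : M * (W * W') = M := by rw [hW, hW', mul_mpow_mul_mpow_neg hM]
  obtain ⟨c, hc⟩ : ∃ c : ℝ, c = Real.sqrt Z⁻¹ := ⟨_, rfl⟩
  have hcc : (c : ℂ) * c = (Z⁻¹ : ℝ) := by
    rw [hc, ← Complex.ofReal_mul, Real.mul_self_sqrt (by positivity)]
  have hTH : ((c : ℂ) • (W * X))ᴴ = (c : ℂ) • (X * W) := by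
    rw [conjTranspose_smul, conjTranspose_mul, hXH, hWH]
    simp
  have hν : ((c : ℂ) • (W * X)) * r * ((c : ℂ) • (X * W)) = ((Z⁻¹ : ℝ) : ℂ) • mpow M α := by
    rw [Matrix.smul_mul, Matrix.smul_mul, Matrix.mul_smul, smul_smul, hcc, ← hWM, hMdef]
    simp only [Matrix.mul_assoc]
  refine ⟨(c : ℂ) • (W * X), ?_, ?_⟩
  · rw [hTH, hν, trace_smul, hZtr, smul_eq_mul, ← Complex.ofReal_mul, inv_mul_cancel₀ hZ.ne',
      Complex.ofReal_one]
  intro ρ hρ hρr σ hσ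
  rw [hTH, hν]
  have hMα := mpow_posSemidef hM α
  have hZi : 0 ≤ Z⁻¹ := by positivity
  have hZic : (0 : ℂ) ≤ ((Z⁻¹ : ℝ) : ℂ) := by exact_mod_cast hZi
  have hνpos : (((Z⁻¹ : ℝ) : ℂ) • mpow M α).PosSemidef := hMα.smul hZic
  obtain ⟨ρt, hρtdef⟩ : ∃ ρt, ρt = (X ⊗ₖ (1 : Matrix B B ℂ)) * ρ * (X ⊗ₖ (1 : Matrix B B ℂ)) :=
    ⟨_, rfl⟩
  have hρt : ρt.PosSemidef := by
    have := hρ.mul_mul_conjTranspose_same (X ⊗ₖ (1 : Matrix B B ℂ))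
    rwa [conjTranspose_kronecker, hXH, conjTranspose_one, ← hρtdef] at this
  have hρtM : ptB ρt = M := by rw [hρtdef, ptB_conj, hρr, hMdef]
  have hmul : ∀ (P Q : Matrix A A ℂ),
      (P * Q) ⊗ₖ (1 : Matrix B B ℂ) = (P ⊗ₖ (1 : Matrix B B ℂ)) * (Q ⊗ₖ (1 : Matrix B B ℂ)) := by
    intro P Q
    rw [← mul_kronecker_mul, Matrix.one_mul]
  have hcomm : ∀ (P : Matrix A A ℂ) (Q : Matrix B B ℂ),
      (P ⊗ₖ (1 : Matrix B B ℂ)) * ((1 : Matrix A A ℂ) ⊗ₖ Q)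
        = ((1 : Matrix A A ℂ) ⊗ₖ Q) * (P ⊗ₖ (1 : Matrix B B ℂ)) := by
    intro P Q
    rw [← mul_kronecker_mul, ← mul_kronecker_mul]
    simp
  have hsplit : ∀ (P : Matrix A A ℂ) (Q : Matrix B B ℂ),
      P ⊗ₖ Q = (P ⊗ₖ (1 : Matrix B B ℂ)) * ((1 : Matrix A A ℂ) ⊗ₖ Q) := by
    intro P Q
    rw [← mul_kronecker_mul]
    simp
  -- the compressed extension is supported on the support of its marginal
  have hright : ρt * (W ⊗ₖ (1 : Matrix B B ℂ)) * (W' ⊗ₖ (1 : Matrix B B ℂ)) = ρt := by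
    rw [Matrix.mul_assoc, ← hmul, mul_kronecker_one_eq_self hρt (by rw [hρtM, hMWW])]
  have hleft : (W' ⊗ₖ (1 : Matrix B B ℂ)) * ((W ⊗ₖ (1 : Matrix B B ℂ)) * ρt) = ρt := by
    have := congrArg conjTranspose hright
    have hW'H : W'ᴴ = W' := by rw [hW']; exact (mpow_posSemidef hM _).1
    simpa only [conjTranspose_mul, conjTranspose_kronecker, hWH, hW'H, hρt.1.eq,
      conjTranspose_one] using this
  obtain ⟨ω, hωdef⟩ : ∃ ω, ω = (((c : ℂ) • (W * X)) ⊗ₖ (1 : Matrix B B ℂ)) * ρ *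
      (((c : ℂ) • (X * W)) ⊗ₖ (1 : Matrix B B ℂ)) := ⟨_, rfl⟩
  have hω : ω = ((Z⁻¹ : ℝ) : ℂ) •
      ((W ⊗ₖ (1 : Matrix B B ℂ)) * ρt * (W ⊗ₖ (1 : Matrix B B ℂ))) := by
    rw [hωdef, smul_kronecker, smul_kronecker, Matrix.smul_mul, Matrix.smul_mul, Matrix.mul_smul,
      smul_smul, hcc, hmul, hmul, hρtdef]
    simp only [Matrix.mul_assoc]
  have hωpos : ω.PosSemidef := by
    have := (hρt.mul_mul_conjTranspose_same (W ⊗ₖ (1 : Matrix B B ℂ))).smul hZic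
    rwa [conjTranspose_kronecker, hWH, conjTranspose_one, ← hω] at this
  have hων : ptB ω = ((Z⁻¹ : ℝ) : ℂ) • mpow M α := by rw [hωdef, ptB_conj, hρr, hν]
  have hωtr : ω.trace = 1 := by
    rw [← trace_ptB, hων, trace_smul, hZtr, smul_eq_mul, ← Complex.ofReal_mul,
      inv_mul_cancel₀ hZ.ne', Complex.ofReal_one]
  have hρtr : ρ.trace = 1 := by rw [← trace_ptB, hρr, hrtr]
  have hω0 : ω ≠ 0 := fun h => by simp [h] at hωtr
  rw [← hωdef]
  have hτσ := hτ.kronecker hσ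
  have hνσ := hνpos.kronecker hσ
  -- the two sandwiched operators are proportional
  obtain ⟨G, hG⟩ : ∃ G, G = mpow (τ ⊗ₖ σ) s * ρ * mpow (τ ⊗ₖ σ) s := ⟨_, rfl⟩
  have hGpos : G.PosSemidef := by rw [hG]; exact sandwich_posSemidef hρ hτσ s
  have hG1 : G = ((1 : Matrix A A ℂ) ⊗ₖ mpow σ s) * ρt * ((1 : Matrix A A ℂ) ⊗ₖ mpow σ s) := by
    rw [hG, mpow_kronecker hτ hσ, ← hX, hρtdef]
    conv_lhs => rw [hsplit X, hcomm]
    simp only [Matrix.mul_assoc]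
    rw [hcomm]
  have hνs : mpow (((Z⁻¹ : ℝ) : ℂ) • mpow M α) s = ((Z⁻¹ ^ s : ℝ) : ℂ) • W' := by
    rw [mpow_smul hMα hZi, mpow_mpow hM, hW', hs, ha]
    congr 2
    field_simp
    ring
  have hG2 : mpow ((((Z⁻¹ : ℝ) : ℂ) • mpow M α) ⊗ₖ σ) s * ω *
      mpow ((((Z⁻¹ : ℝ) : ℂ) • mpow M α) ⊗ₖ σ) s = ((Z⁻¹ ^ α⁻¹ : ℝ) : ℂ) • G := by
    have hk : Z⁻¹ ^ s * Z⁻¹ * Z⁻¹ ^ s = Z⁻¹ ^ α⁻¹ := by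
      have hZp : 0 < Z⁻¹ := by positivity
      rw [← Real.rpow_add_one hZp.ne', ← Real.rpow_add hZp]
      congr 1
      rw [hs]
      field_simp
      ring
    rw [mpow_kronecker hνpos hσ, hνs, smul_kronecker, hω, hG1, Matrix.smul_mul, Matrix.smul_mul,
      Matrix.mul_smul, Matrix.mul_smul, Matrix.smul_mul, smul_smul, smul_smul, ← hk]
    push_cast
    congr 1
    · ring
    calc _ = ((1 : Matrix A A ℂ) ⊗ₖ mpow σ s) *
          ((W' ⊗ₖ (1 : Matrix B B ℂ)) * ((W ⊗ₖ (1 : Matrix B B ℂ)) * ρt)) *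
          (W ⊗ₖ (1 : Matrix B B ℂ)) * (W' ⊗ₖ (1 : Matrix B B ℂ)) *
          ((1 : Matrix A A ℂ) ⊗ₖ mpow σ s) := by
          conv_lhs => rw [hsplit W', hcomm]
          simp only [Matrix.mul_assoc]
          rw [hcomm]
      _ = _ := by
          rw [hleft, Matrix.mul_assoc _ ρt, Matrix.mul_assoc _ (ρt * _), hright]
  obtain ⟨hcond, hDr⟩ := D_cases hfin
  by_cases htop : D α ω ((((Z⁻¹ : ℝ) : ℂ) • mpow M α) ⊗ₖ σ) = ⊤
  · rw [htop, hDr, EReal.coe_add_top]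
    exact le_top
  obtain ⟨hcond', hDω⟩ := D_cases htop
  have hG0 : G ≠ 0 := by
    intro h
    refine sandwich_ne_zero hωpos hνσ hω0 hs0 htop ?_
    rw [hG2, h, smul_zero]
  have hρcond : (α < 1 ∧ ¬ (ρ * (τ ⊗ₖ σ) = 0 ∧ (τ ⊗ₖ σ) * ρ = 0)) ∨ suppSubset ρ (τ ⊗ₖ σ) := by
    rcases h1.lt_or_gt with h1 | h1
    · left
      refine ⟨h1, ?_⟩
      rw [← sandwich_eq_zero_iff hρ hτσ hs0, ← hG]
      exact hG0
    right
    replace hcond := hcond.resolve_left fun h => by linarith [h.1]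
    replace hcond' := hcond'.resolve_left fun h => by linarith [h.1]
    obtain ⟨S, hS⟩ : ∃ S, S = mpow σ 1 * mpow σ (-1) := ⟨_, rfl⟩
    have hρτ : ∀ p, ρ * ((mpow τ p * mpow τ (-p)) ⊗ₖ (1 : Matrix B B ℂ)) = ρ := fun p =>
      mul_kronecker_one_eq_self hρ (by rw [hρr, hcond.mul_mpow hτ])
    have hωS : ω * ((1 : Matrix A A ℂ) ⊗ₖ S) = ω := by
      have e1 := hcond'.mul_mpow hνσ 1
      rw [mpow_kronecker hνpos hσ, mpow_kronecker hνpos hσ, ← mul_kronecker_mul, ← hS, hsplit,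
        ← Matrix.mul_assoc, mul_kronecker_one_eq_self hωpos] at e1
      · exact e1
      · rw [hων, mul_mpow_mul_mpow_neg hνpos]
    obtain ⟨P, hP⟩ : ∃ P : Matrix B B ℂ, P = S - 1 := ⟨_, rfl⟩
    have hkP : (1 : Matrix A A ℂ) ⊗ₖ P = (1 : Matrix A A ℂ) ⊗ₖ S - 1 := by
      rw [hP, ← one_kronecker_one]
      ext
      simp only [kroneckerMap_apply, Matrix.sub_apply, mul_sub]
    have hωP : ω * ((1 : Matrix A A ℂ) ⊗ₖ P) = 0 := by
      rw [hkP, Matrix.mul_sub, hωS, Matrix.mul_one, sub_self]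
    have hρtP : ρt * ((1 : Matrix A A ℂ) ⊗ₖ P) = 0 := by
      have hZc : ((Z⁻¹ : ℝ) : ℂ) ≠ 0 := by exact_mod_cast (inv_pos.mpr hZ).ne'
      rw [hω, Matrix.smul_mul, smul_eq_zero_iff_right hZc] at hωP
      calc ρt * ((1 : Matrix A A ℂ) ⊗ₖ P)
          = (W' ⊗ₖ (1 : Matrix B B ℂ)) * ((W ⊗ₖ (1 : Matrix B B ℂ)) * ρt) *
            (W ⊗ₖ (1 : Matrix B B ℂ)) * (W' ⊗ₖ (1 : Matrix B B ℂ)) *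
            ((1 : Matrix A A ℂ) ⊗ₖ P) := by rw [hleft, hright]
        _ = (W' ⊗ₖ (1 : Matrix B B ℂ)) * ((W ⊗ₖ (1 : Matrix B B ℂ)) * ρt *
            (W ⊗ₖ (1 : Matrix B B ℂ)) * ((1 : Matrix A A ℂ) ⊗ₖ P)) *
            (W' ⊗ₖ (1 : Matrix B B ℂ)) := by
            simp only [Matrix.mul_assoc]
            rw [hcomm]
        _ = 0 := by rw [hωP]; simp
    have hρXP : ρ * ((X ⊗ₖ (1 : Matrix B B ℂ)) * ((1 : Matrix A A ℂ) ⊗ₖ P)) = 0 := by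
      apply mul_eq_zero_of_conj_eq_zero hρ
      rw [conjTranspose_mul, conjTranspose_kronecker X, hXH, conjTranspose_one]
      calc _ = ((1 : Matrix A A ℂ) ⊗ₖ P)ᴴ * (ρt * ((1 : Matrix A A ℂ) ⊗ₖ P)) := by
            rw [hρtdef]
            simp only [Matrix.mul_assoc]
        _ = 0 := by rw [hρtP, Matrix.mul_zero]
    have hρP : ρ * ((1 : Matrix A A ℂ) ⊗ₖ P) = 0 := by
      calc ρ * ((1 : Matrix A A ℂ) ⊗ₖ P)
          = ρ * ((X ⊗ₖ (1 : Matrix B B ℂ)) * (mpow τ (-s) ⊗ₖ (1 : Matrix B B ℂ))) *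
            ((1 : Matrix A A ℂ) ⊗ₖ P) := by rw [← hmul, hX, hρτ]
        _ = ρ * ((X ⊗ₖ (1 : Matrix B B ℂ)) * ((1 : Matrix A A ℂ) ⊗ₖ P)) *
            (mpow τ (-s) ⊗ₖ (1 : Matrix B B ℂ)) := by
            simp only [Matrix.mul_assoc]
            rw [hcomm]
        _ = 0 := by rw [hρXP, Matrix.zero_mul]
    refine suppSubset_of_mul_eq hτσ ?_
    rw [mpow_kronecker hτ hσ, mpow_kronecker hτ hσ, ← mul_kronecker_mul, ← hS, hsplit,
      ← Matrix.mul_assoc, hρτ]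
    rwa [hkP, Matrix.mul_sub, Matrix.mul_one, sub_eq_zero] at hρP
  have hDρ : D α ρ (τ ⊗ₖ σ) = (DR α ρ (τ ⊗ₖ σ) : ℝ) := if_pos hρcond
  have hQ : (mpow (((Z⁻¹ ^ α⁻¹ : ℝ) : ℂ) • G) α).trace.re = Z⁻¹ * (mpow G α).trace.re := by
    rw [mpow_smul hGpos (Real.rpow_nonneg hZi _), ← Real.rpow_mul hZi, inv_mul_cancel₀ h0.ne',
      Real.rpow_one, trace_smul, smul_eq_mul, Complex.re_ofReal_mul]
  rw [hDρ, hDr, hDω, ← EReal.coe_add, EReal.coe_le_coe_iff]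
  unfold DR
  rw [← hs, ← hX, ← hMdef, ← hZdef, ← hG, hG2, hQ, hρtr, hωtr, hrtr, Complex.one_re, div_one,
    div_one, div_one, Real.logb_mul (inv_pos.mpr hZ).ne' (trace_mpow_pos hGpos hG0 α).ne',
    Real.logb_inv, ← mul_add]
  apply le_of_eq
  ring

end Divergence

lemma isState_kronecker [Fintype A] [Fintype B] {ω : Matrix A A ℂ} {σ : Matrix B B ℂ}
    (hω : IsState ω) (hσ : IsState σ) : IsState (ω ⊗ₖ σ) :=
  ⟨hω.1.kronecker hσ.1, by rw [trace_kronecker, hω.2, hσ.2, one_mul]⟩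

lemma isState_ptB [Fintype A] [Fintype B] {ρ : Matrix (A × B) (A × B) ℂ} (hρ : IsState ρ) :
    IsState (ptB ρ) :=
  ⟨ptB_posSemidef hρ.1, by rw [trace_ptB, hρ.2]⟩

lemma Idown_ne_bot [Fintype A] [DecidableEq A] [Fintype B] [DecidableEq B] {α : ℝ} (h0 : 0 < α)
    (h1 : α ≠ 1) {ρ : Matrix (A × B) (A × B) ℂ} (hρ : IsState ρ) : Idown α ρ ≠ ⊥ := by
  obtain ⟨c, hc⟩ := exists_le_D (A := A × B) h0 h1
  have : (c : EReal) ≤ Idown α ρ := by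
    refine le_sInf ?_
    rintro _ ⟨σ, hσ, rfl⟩
    exact hc _ _ hρ (isState_kronecker (isState_ptB hρ) hσ)
  exact fun h => by simp [h] at this

theorem renyi_mutual_information_chain_channel
    {A B C R : Type*} [Fintype A] [DecidableEq A] [Fintype B] [DecidableEq B]
    [Fintype C] [DecidableEq C] [Fintype R] [DecidableEq R]
    (ρ' : Matrix ((C × A) × R) ((C × A) × R) ℂ) (hρ' : IsState ρ')
    (N : Matrix R R ℂ →ₗ[ℂ] Matrix B B ℂ) (hN : IsCPTP N)
    (α : ℝ) (hα : α ∈ Set.Ioo (0 : ℝ) 1 ∪ Set.Ioi (1 : ℝ)) :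
    Idown α ((Matrix.reindex (eCA_B C A B) (eCA_B C A B)) ((lext N) ρ'))
      ≤ Idown α (ptB ρ')
        + sSup {x : EReal | ∃ ω : Matrix ((C × A) × R) ((C × A) × R) ℂ,
            IsState ω ∧ x = Idown α ((lext N) ω)} := by
  obtain ⟨h0, h1⟩ : 0 < α ∧ α ≠ 1 := by
    rcases hα with h | h
    · exact ⟨h.1, h.2.ne⟩
    · exact ⟨zero_lt_one.trans h, (Set.mem_Ioi.mp h).ne'⟩
  have hlext : ∀ ω : Matrix ((C × A) × R) ((C × A) × R) ℂ, IsState ω → IsState (lext N ω) :=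
    fun ω hω => ⟨lext_posSemidef N hN hω.1, by rw [← trace_ptB, ptB_lext N hN, trace_ptB, hω.2]⟩
  have hr := isState_ptB hρ'
  have hNρ := hlext _ hρ'
  set q := sSup {x : EReal | ∃ ω : Matrix ((C × A) × R) ((C × A) × R) ℂ,
    IsState ω ∧ x = Idown α ((lext N) ω)}
  have hqle : ∀ ω : Matrix ((C × A) × R) ((C × A) × R) ℂ, IsState ω → Idown α (lext N ω) ≤ q :=
    fun ω hω => le_sSup ⟨ω, hω, rfl⟩
  have hqbot : q ≠ ⊥ := fun h =>
    Idown_ne_bot h0 h1 hNρ (le_bot_iff.mp (h ▸ hqle ρ' hρ'))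
  have hIbot := Idown_ne_bot h0 h1 hr
  rw [← EReal.sub_le_iff_le_add (Or.inl hqbot) (Or.inr hIbot)]
  refine le_sInf ?_
  rintro _ ⟨σ, hσ, rfl⟩
  have hτ := isState_kronecker (isState_ptB hr) hσ
  by_cases htop : D α (ptB ρ') (ptB (ptB ρ') ⊗ₖ σ) = ⊤
  · rw [htop]; exact le_top
  have hDbot : D α (ptB ρ') (ptB (ptB ρ') ⊗ₖ σ) ≠ ⊥ := by
    rw [(D_cases htop).2]
    exact EReal.coe_ne_bot _
  rw [EReal.sub_le_iff_le_add (Or.inl hqbot) (Or.inr hDbot)]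
  obtain ⟨T, hT, hchain⟩ := exists_tilt B hr.1 hτ.1 hr.2 h0 h1 htop
  set ω := (T ⊗ₖ (1 : Matrix R R ℂ)) * ρ' * (Tᴴ ⊗ₖ (1 : Matrix R R ℂ))
  have hωr : ptB ω = T * ptB ρ' * Tᴴ := ptB_conj _ _ _
  have hωs : IsState ω := by
    refine ⟨?_, by rw [← trace_ptB, hωr, hT]⟩
    have := hρ'.1.mul_mul_conjTranspose_same (T ⊗ₖ (1 : Matrix R R ℂ))
    rwa [conjTranspose_kronecker, conjTranspose_one] at this
  have hNω : lext N ω = (T ⊗ₖ (1 : Matrix B B ℂ)) * lext N ρ' * (Tᴴ ⊗ₖ (1 : Matrix B B ℂ)) :=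
    lext_conj N T Tᴴ ρ'
  refine le_trans ?_ (add_le_add_right (hqle ω hωs) _)
  rw [add_comm, ← EReal.sub_le_iff_le_add (Or.inl hDbot) (Or.inl htop)]
  refine le_sInf ?_
  rintro _ ⟨σ', hσ', rfl⟩
  rw [EReal.sub_le_iff_le_add (Or.inl hDbot) (Or.inl htop), add_comm]
  have key := hchain (lext N ρ') hNρ.1 (ptB_lext N hN ρ') σ' hσ'.1
  rw [← hNω, ← hωr, ← ptB_lext N hN ω] at key
  refine le_trans (sInf_le ⟨σ ⊗ₖ σ', isState_kronecker hσ hσ', ?_⟩) key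
  rw [← D_reindex (eCA_B C A B) hNρ.1 (hτ.1.kronecker hσ'.1)]
  congr 1
  ext ⟨i, j, k⟩ ⟨i', j', k'⟩
  have hm : ptB (Matrix.reindex (eCA_B C A B) (eCA_B C A B) (lext N ρ')) = ptB (ptB ρ') := by
    rw [← ptB_lext N hN ρ']
    ext i i'
    simp [ptB, eCA_B, Fintype.sum_prod_type]
  rw [hm]
  simp [eCA_B, mul_assoc]

end QITLeak
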